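/- arXiv:2512.12910 — 6 statements merged into one kernel-verified Lean document; each statement's English description precedes it below -/
import Mathlib

section
/- Let γ > 0. The residual operator R(z) = z - T(z), where T(z) = z - Π_S(z) + M_γ⁻¹(2Π_S(z) - z), is monotone: for all z₁, z₂ ∈ ℝ^{n+m}, ⟨z₁ - z₂, R(z₁) - R(z₂)⟩ ≥ 0. -/
open Matrix
open scoped InnerProductSpace

noncomputable section

/-- The probability simplex `Δᵈ = {x ∈ ℝᵈ : xᵢ ≥ 0, ∑ᵢ xᵢ = 1}` in Euclidean space. -/
def simplex (d : ℕ) : Set (EuclideanSpace ℝ (Fin d)) :=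
  {x | (∀ i, 0 ≤ x i) ∧ ∑ i, x i = 1}

/-- `S = Δⁿ × Δᵐ ⊆ ℝ^{n+m}`, with coordinates indexed by `Fin n ⊕ Fin m`. -/
def gameSet (n m : ℕ) : Set (EuclideanSpace ℝ (Fin n ⊕ Fin m)) :=
  {z | (∀ i, 0 ≤ z i) ∧ (∑ i : Fin n, z (Sum.inl i)) = 1 ∧ (∑ j : Fin m, z (Sum.inr j)) = 1}

/-- The skew block matrix `K = [[0, A], [-Aᵀ, 0]]`. -/
def Kmat {n m : ℕ} (A : Matrix (Fin n) (Fin m) ℝ) :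
    Matrix (Fin n ⊕ Fin m) (Fin n ⊕ Fin m) ℝ :=
  Matrix.fromBlocks 0 A (-Aᵀ) 0

/-- The block matrix `M_γ = [[I, γA], [-γAᵀ, I]] = I + γK`. -/
def Mmat {n m : ℕ} (A : Matrix (Fin n) (Fin m) ℝ) (γ : ℝ) :
    Matrix (Fin n ⊕ Fin m) (Fin n ⊕ Fin m) ℝ :=
  1 + γ • Kmat A

/-- The game operator `F(x, y) = (A y, -Aᵀ x)`. -/
def Fop {n m : ℕ} (A : Matrix (Fin n) (Fin m) ℝ)
    (z : EuclideanSpace ℝ (Fin n ⊕ Fin m)) : EuclideanSpace ℝ (Fin n ⊕ Fin m) :=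
  Matrix.toEuclideanLin (Kmat A) z

/-- The operator (spectral) norm of a matrix, induced by Euclidean norms. -/
def opNorm {n m : ℕ} (A : Matrix (Fin n) (Fin m) ℝ) : ℝ :=
  ‖LinearMap.toContinuousLinearMap (Matrix.toEuclideanLin A)‖

/-- The duality gap `gap(x, y) = max_{y'∈Δᵐ} xᵀAy' - min_{x'∈Δⁿ} x'ᵀAy`. -/
def gap {n m : ℕ} (A : Matrix (Fin n) (Fin m) ℝ)
    (z : EuclideanSpace ℝ (Fin n ⊕ Fin m)) : ℝ :=
  sSup ((fun y' : EuclideanSpace ℝ (Fin m) =>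
      ∑ i : Fin n, ∑ j : Fin m, z (Sum.inl i) * A i j * y' j) '' simplex m)
    - sInf ((fun x' : EuclideanSpace ℝ (Fin n) =>
      ∑ i : Fin n, ∑ j : Fin m, x' i * A i j * z (Sum.inr j)) '' simplex n)

/-- The set `S = Δⁿ × Δᵐ` is convex. -/
lemma convex_gameSet (n m : ℕ) : Convex ℝ (gameSet n m) := by
  rintro x ⟨hx, hx₁, hx₂⟩ y ⟨hy, hy₁, hy₂⟩ a b ha hb hab
  refine ⟨fun i => ?_, ?_, ?_⟩
  · have := hx i
    have := hy i
    simp only [PiLp.add_apply, PiLp.smul_apply, smul_eq_mul]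
    positivity
  · simp [Finset.sum_add_distrib, ← Finset.mul_sum, hx₁, hy₁, hab]
  · simp [Finset.sum_add_distrib, ← Finset.mul_sum, hx₂, hy₂, hab]

/-- A nearest point of a convex set satisfies the obtuse angle criterion. -/
lemma Convex.inner_sub_nearest_nonpos {E : Type*} [NormedAddCommGroup E] [InnerProductSpace ℝ E]
    {s : Set E} (hs : Convex ℝ s) {u v : E} (hv : v ∈ s) (h : ∀ w ∈ s, ‖u - v‖ ≤ ‖u - w‖)
    {w : E} (hw : w ∈ s) : ⟪u - v, w - v⟫_ℝ ≤ 0 := by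
  refine (norm_eq_iInf_iff_real_inner_le_zero hs hv).1 (le_antisymm ?_ ?_) w hw
  · have : Nonempty s := ⟨⟨v, hv⟩⟩
    exact le_ciInf fun w => h w w.2
  · exact ciInf_le (f := fun w : s => ‖u - w‖)
      ⟨0, by rintro _ ⟨w, rfl⟩; exact norm_nonneg _⟩ ⟨v, hv⟩

/-- A nearest-point map onto a convex set is firmly nonexpansive. -/
lemma Convex.inner_nearest_sub_nonneg {E : Type*} [NormedAddCommGroup E] [InnerProductSpace ℝ E]
    {s : Set E} (hs : Convex ℝ s) {P : E → E}
    (hP : ∀ z, P z ∈ s ∧ ∀ w ∈ s, ‖z - P z‖ ≤ ‖z - w‖) (x y : E) :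
    0 ≤ ⟪P x - P y, (x - y) - (P x - P y)⟫_ℝ := by
  have hx := hs.inner_sub_nearest_nonpos (hP x).1 (hP x).2 (hP y).1
  have hy := hs.inner_sub_nearest_nonpos (hP y).1 (hP y).2 (hP x).1
  simp only [inner_sub_left, inner_sub_right] at hx hy ⊢
  linarith [real_inner_comm x (P x), real_inner_comm x (P y), real_inner_comm y (P x),
    real_inner_comm y (P y), real_inner_comm (P x) (P y)]

lemma Kmat_transpose {n m : ℕ} (A : Matrix (Fin n) (Fin m) ℝ) : (Kmat A)ᵀ = -Kmat A := by
  simp [Kmat, Matrix.fromBlocks_transpose, Matrix.fromBlocks_neg]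

lemma dotProduct_Kmat_mulVec_self {n m : ℕ} (A : Matrix (Fin n) (Fin m) ℝ)
    (v : Fin n ⊕ Fin m → ℝ) : v ⬝ᵥ Kmat A *ᵥ v = 0 := by
  have h : v ⬝ᵥ Kmat A *ᵥ v = -(v ⬝ᵥ Kmat A *ᵥ v) := by
    conv_lhs => rw [dotProduct_mulVec, ← mulVec_transpose, Kmat_transpose, neg_mulVec,
      neg_dotProduct, dotProduct_comm]
  linarith

lemma dotProduct_Mmat_mulVec_self {n m : ℕ} (A : Matrix (Fin n) (Fin m) ℝ) (γ : ℝ)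
    (v : Fin n ⊕ Fin m → ℝ) : v ⬝ᵥ Mmat A γ *ᵥ v = v ⬝ᵥ v := by
  simp [Mmat, add_mulVec, smul_mulVec, dotProduct_add, dotProduct_Kmat_mulVec_self]

lemma isUnit_Mmat {n m : ℕ} (A : Matrix (Fin n) (Fin m) ℝ) (γ : ℝ) : IsUnit (Mmat A γ) := by
  rw [← mulVec_injective_iff_isUnit]
  refine (injective_iff_map_eq_zero (Mmat A γ).mulVecLin).2 fun v hv => ?_
  rw [mulVecLin_apply] at hv
  rw [← dotProduct_self_eq_zero, ← dotProduct_Mmat_mulVec_self A γ, hv, dotProduct_zero]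

/-- The resolvent `M_γ⁻¹` satisfies `⟨M_γ⁻¹ u, u - M_γ⁻¹ u⟩ = 0`, since `M_γ - I` is skew. -/
lemma inner_Mmat_inv_sub {n m : ℕ} (A : Matrix (Fin n) (Fin m) ℝ) (γ : ℝ)
    (u : EuclideanSpace ℝ (Fin n ⊕ Fin m)) :
    ⟪Matrix.toEuclideanLin (Mmat A γ)⁻¹ u, u - Matrix.toEuclideanLin (Mmat A γ)⁻¹ u⟫_ℝ = 0 := by
  have hM : Mmat A γ *ᵥ ((Mmat A γ)⁻¹ *ᵥ u.ofLp) = u.ofLp := by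
    rw [mulVec_mulVec, mul_nonsing_inv _ ((isUnit_iff_isUnit_det _).1 (isUnit_Mmat A γ)),
      one_mulVec]
  have h := dotProduct_Mmat_mulVec_self A γ ((Mmat A γ)⁻¹ *ᵥ u.ofLp)
  rw [hM] at h
  rw [inner_sub_right, EuclideanSpace.inner_eq_star_dotProduct,
    EuclideanSpace.inner_eq_star_dotProduct]
  simp [dotProduct_comm u.ofLp, h]

theorem drs_residual_monotone {n m : ℕ} (A : Matrix (Fin n) (Fin m) ℝ)
    (γ : ℝ) (hγ : 0 < γ)
    (proj : EuclideanSpace ℝ (Fin n ⊕ Fin m) → EuclideanSpace ℝ (Fin n ⊕ Fin m))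
    (hproj : ∀ z, proj z ∈ gameSet n m ∧ ∀ w ∈ gameSet n m, ‖z - proj z‖ ≤ ‖z - w‖)
    (T : EuclideanSpace ℝ (Fin n ⊕ Fin m) → EuclideanSpace ℝ (Fin n ⊕ Fin m))
    (hT : ∀ z, T z = z - proj z +
      Matrix.toEuclideanLin (Mmat A γ)⁻¹ ((2 : ℝ) • proj z - z))
    (R : EuclideanSpace ℝ (Fin n ⊕ Fin m) → EuclideanSpace ℝ (Fin n ⊕ Fin m))
    (hR : ∀ z, R z = z - T z) :
    ∀ z₁ z₂ : EuclideanSpace ℝ (Fin n ⊕ Fin m),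
      0 ≤ ⟪z₁ - z₂, R z₁ - R z₂⟫_ℝ := by
  intro z₁ z₂
  have hP := (convex_gameSet n m).inner_nearest_sub_nonneg hproj z₁ z₂
  have hJ := inner_Mmat_inv_sub A γ ((2 : ℝ) • (proj z₁ - proj z₂) - (z₁ - z₂))
  have hRd : R z₁ - R z₂ = (proj z₁ - proj z₂) - Matrix.toEuclideanLin (Mmat A γ)⁻¹
      ((2 : ℝ) • (proj z₁ - proj z₂) - (z₁ - z₂)) := by
    simp only [hR, hT, map_sub, map_smul]
    module
  rw [hRd]
  generalize Matrix.toEuclideanLin (Mmat A γ)⁻¹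
    ((2 : ℝ) • (proj z₁ - proj z₂) - (z₁ - z₂)) = q at hJ ⊢
  generalize proj z₁ - proj z₂ = p at hP hJ ⊢
  generalize z₁ - z₂ = d at hP hJ ⊢
  have hsq := real_inner_self_nonneg (x := p - q)
  simp only [inner_sub_left, inner_sub_right, inner_smul_right] at hP hJ hsq ⊢
  linarith [real_inner_comm p q, real_inner_comm p d, real_inner_comm q d]

end
end

section
/- Let γ > 0 and T(z) = z - Π_S(z) + M_γ⁻¹(2Π_S(z) - z). If ẑ ∈ S is a Nash equilibrium, i.e. ⟨F(ẑ), z' - ẑ⟩ ≥ 0 for all z' ∈ S, then the lifted point z = ẑ - γ F(ẑ) is a fixed point of T: T(z) = z. -/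
open Matrix
open scoped InnerProductSpace

noncomputable section

/-- A matrix with `Kᵀ = -K` has vanishing quadratic form. -/
lemma dotProduct_mulVec_self_of_transpose_eq_neg {ι : Type*} [Fintype ι] {K : Matrix ι ι ℝ}
    (hK : Kᵀ = -K) (v : ι → ℝ) : v ⬝ᵥ K *ᵥ v = 0 := by
  have h : v ⬝ᵥ K *ᵥ v = -(v ⬝ᵥ K *ᵥ v) := by
    conv_lhs => rw [dotProduct_mulVec, ← mulVec_transpose, hK, neg_mulVec, neg_dotProduct,
      dotProduct_comm]
  linarith

lemma toEuclideanLin_Mmat {n m : ℕ} (A : Matrix (Fin n) (Fin m) ℝ) (γ : ℝ)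
    (z : EuclideanSpace ℝ (Fin n ⊕ Fin m)) :
    Matrix.toEuclideanLin (Mmat A γ) z = z + γ • Fop A z := by
  ext i
  simp [Mmat, Fop, toLpLin_apply]

lemma toEuclideanLin_Mmat_inv {n m : ℕ} (A : Matrix (Fin n) (Fin m) ℝ) (γ : ℝ)
    (z : EuclideanSpace ℝ (Fin n ⊕ Fin m)) :
    Matrix.toEuclideanLin (Mmat A γ)⁻¹ (z + γ • Fop A z) = z := by
  rw [← toEuclideanLin_Mmat]
  ext i
  simp [toLpLin_apply, nonsing_inv_mul _ ((isUnit_iff_isUnit_det _).mp (isUnit_Mmat A γ))]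

/-- A solution `x` of the variational inequality for `f` is the only closest point
to `x - γ • f`. -/
lemma eq_of_norm_sub_le_of_inner_nonneg {E : Type*} [NormedAddCommGroup E]
    [InnerProductSpace ℝ E] {γ : ℝ} (hγ : 0 ≤ γ) {x p f : E} (hf : 0 ≤ ⟪f, p - x⟫_ℝ)
    (hp : ‖x - γ • f - p‖ ≤ ‖x - γ • f - x‖) : p = x := by
  rw [show x - γ • f - p = -(γ • f + (p - x)) by abel, show x - γ • f - x = -(γ • f) by abel,
    norm_neg, norm_neg] at hp
  have hsq := pow_le_pow_left₀ (norm_nonneg _) hp 2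
  rw [norm_add_sq_real, real_inner_smul_left] at hsq
  have hd : ‖p - x‖ ^ 2 ≤ 0 := by linarith [mul_nonneg hγ hf]
  exact sub_eq_zero.mp (norm_eq_zero.mp (pow_eq_zero_iff two_ne_zero |>.mp
    (hd.antisymm (sq_nonneg _))))

theorem nash_lift_is_fixed_point {n m : ℕ} (A : Matrix (Fin n) (Fin m) ℝ)
    (γ : ℝ) (hγ : 0 < γ)
    (proj : EuclideanSpace ℝ (Fin n ⊕ Fin m) → EuclideanSpace ℝ (Fin n ⊕ Fin m))
    (hproj : ∀ z, proj z ∈ gameSet n m ∧ ∀ w ∈ gameSet n m, ‖z - proj z‖ ≤ ‖z - w‖)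
    (T : EuclideanSpace ℝ (Fin n ⊕ Fin m) → EuclideanSpace ℝ (Fin n ⊕ Fin m))
    (hT : ∀ z, T z = z - proj z +
      Matrix.toEuclideanLin (Mmat A γ)⁻¹ ((2 : ℝ) • proj z - z))
    (zhat : EuclideanSpace ℝ (Fin n ⊕ Fin m)) (hzhat : zhat ∈ gameSet n m)
    (hnash : ∀ z' ∈ gameSet n m, 0 ≤ ⟪Fop A zhat, z' - zhat⟫_ℝ) :
    T (zhat - γ • Fop A zhat) = zhat - γ • Fop A zhat := by
  have hp : proj (zhat - γ • Fop A zhat) = zhat :=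
    eq_of_norm_sub_le_of_inner_nonneg hγ.le (hnash _ (hproj _).1) ((hproj _).2 zhat hzhat)
  rw [hT, hp, show (2 : ℝ) • zhat - (zhat - γ • Fop A zhat) = zhat + γ • Fop A zhat by module,
    toEuclideanLin_Mmat_inv, sub_add_cancel]

end
end

section
/- Let p ∈ ℝᵈ and let x = Π_{Δᵈ}(p) be the Euclidean projection of p onto the probability simplex Δᵈ. Define the active set 𝒜 = {i : xᵢ > 0}. Then 𝒜 is nonempty, and for every i ∈ 𝒜 one has xᵢ = pᵢ - α, where α = (∑_{j∈𝒜} pⱼ - 1)/|𝒜|. -/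
open Matrix
open scoped InnerProductSpace

noncomputable section

theorem convex_simplex (d : ℕ) : Convex ℝ (simplex d) := by
  rintro x ⟨hx, hx1⟩ y ⟨hy, hy1⟩ a b ha hb hab
  refine ⟨fun i => ?_, ?_⟩
  · have := mul_nonneg ha (hx i)
    have := mul_nonneg hb (hy i)
    simp only [PiLp.add_apply, PiLp.smul_apply, smul_eq_mul]
    linarith
  · simp [Finset.sum_add_distrib, ← Finset.mul_sum, hx1, hy1, hab]

/-- The variational inequality for a nearest point of a convex set. -/
theorem inner_sub_sub_nonpos_of_forall_norm_sub_le {E : Type*} [NormedAddCommGroup E]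
    [InnerProductSpace ℝ E] {K : Set E} (hK : Convex ℝ K) {p x : E} (hx : x ∈ K)
    (hmin : ∀ w ∈ K, ‖p - x‖ ≤ ‖p - w‖) {w : E} (hw : w ∈ K) : ⟪p - x, w - x⟫_ℝ ≤ 0 := by
  have : Nonempty K := ⟨⟨x, hx⟩⟩
  refine (norm_eq_iInf_iff_real_inner_le_zero hK hx).1 (le_antisymm ?_ ?_) w hw
  · exact le_ciInf fun w => hmin w w.2
  · exact ciInf_le ⟨0, by rintro _ ⟨w, rfl⟩; positivity⟩ (⟨x, hx⟩ : K)

/-- Transferring the mass of coordinate `i` to coordinate `k` stays in the simplex. -/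
theorem add_smul_single_sub_single_mem_simplex {d : ℕ} {x : EuclideanSpace ℝ (Fin d)}
    (hx : x ∈ simplex d) (i k : Fin d) :
    x + x i • (EuclideanSpace.single k (1 : ℝ) - EuclideanSpace.single i 1) ∈ simplex d := by
  refine ⟨fun j => ?_, ?_⟩
  · have hi := hx.1 i
    have hj := hx.1 j
    simp only [PiLp.add_apply, PiLp.smul_apply, PiLp.sub_apply, PiLp.single_apply, smul_eq_mul]
    split_ifs with hjk hji hji <;> first | (subst hji; linarith) | linarith
  · simp [Finset.sum_add_distrib, ← Finset.mul_sum, Finset.sum_sub_distrib, hx.2]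

/-- The residual of a projection onto the simplex is maximal at the active coordinates. -/
theorem residual_le_of_pos {d : ℕ} {p x : EuclideanSpace ℝ (Fin d)}
    (hx : x ∈ simplex d) (hmin : ∀ w ∈ simplex d, ‖p - x‖ ≤ ‖p - w‖)
    {i : Fin d} (hi : 0 < x i) (k : Fin d) : p k - x k ≤ p i - x i := by
  have h := inner_sub_sub_nonpos_of_forall_norm_sub_le (convex_simplex d) hx hmin
    (add_smul_single_sub_single_mem_simplex hx i k)
  rw [add_sub_cancel_left, real_inner_smul_right, inner_sub_right,
    EuclideanSpace.inner_single_right, EuclideanSpace.inner_single_right] at h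
  have := nonpos_of_mul_nonpos_right h hi
  simp at this
  linarith

theorem simplex_projection_formula {d : ℕ} (p x : EuclideanSpace ℝ (Fin d))
    (hx : x ∈ simplex d) (hmin : ∀ w ∈ simplex d, ‖p - x‖ ≤ ‖p - w‖)
    (𝒜 : Finset (Fin d)) (h𝒜 : 𝒜 = Finset.univ.filter fun i => 0 < x i) :
    𝒜.Nonempty ∧
      ∀ i ∈ 𝒜, x i = p i - ((∑ j ∈ 𝒜, p j) - 1) / (𝒜.card : ℝ) := by
  have mem_iff (i : Fin d) : i ∈ 𝒜 ↔ 0 < x i := by simp [h𝒜]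
  have hsum : ∑ j ∈ 𝒜, x j = 1 := by
    rw [← hx.2]
    refine Finset.sum_subset (Finset.subset_univ _) fun j _ hj => ?_
    exact le_antisymm (not_lt.1 fun h => hj ((mem_iff j).2 h)) (hx.1 j)
  have hne : 𝒜.Nonempty := Finset.nonempty_of_sum_ne_zero (hsum.trans_ne one_ne_zero)
  refine ⟨hne, fun i hi => ?_⟩
  have hres : ∑ j ∈ 𝒜, (p j - x j) = 𝒜.card * (p i - x i) := by
    rw [← nsmul_eq_mul]
    refine Finset.sum_eq_card_nsmul fun j hj => le_antisymm ?_ ?_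
    · exact residual_le_of_pos hx hmin ((mem_iff i).1 hi) j
    · exact residual_le_of_pos hx hmin ((mem_iff j).1 hj) i
  rw [Finset.sum_sub_distrib, hsum] at hres
  have hcard : (𝒜.card : ℝ) ≠ 0 := Nat.cast_ne_zero.2 hne.card_ne_zero
  rw [hres, mul_div_cancel_left₀ _ hcard, sub_sub_cancel]

end
end

section
/- Let F : ℝᵈ → ℝᵈ, let z ∈ ℝᵈ with F(z) ≠ 0, let z* ∈ ℝᵈ with F(z*) = 0, let θ, τ, L₂ > 0, and let G be a real d×d matrix such that: (a) ⟨x, Gx⟩ ≥ 0 for all x; (b) ‖F(z) - G(z - z*)‖ ≤ L₂‖z - z*‖²; (c) ‖F(z)‖ ≥ τ‖z - z*‖. Define the regularized Newton step Δz = -(G + θ‖F(z)‖·I)⁻¹ F(z). Then ‖Δz‖ ≤ (2 + L₂/(θτ)) ‖z - z*‖. -/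
open Matrix
open scoped InnerProductSpace

noncomputable section

/-- If `G` is monotone then `G + c I` is bounded below by `c`. -/
theorem mul_norm_le_norm_toEuclideanLin_add_smul_one {ι : Type*} [Fintype ι] [DecidableEq ι]
    {G : Matrix ι ι ℝ}
    (hG : ∀ x : EuclideanSpace ℝ ι, 0 ≤ ⟪x, Matrix.toEuclideanLin G x⟫_ℝ)
    (c : ℝ) (x : EuclideanSpace ℝ ι) :
    c * ‖x‖ ≤ ‖Matrix.toEuclideanLin (G + c • (1 : Matrix ι ι ℝ)) x‖ := by
  rcases eq_or_ne x 0 with rfl | hx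
  · simp
  have hinner : ⟪x, Matrix.toEuclideanLin (G + c • (1 : Matrix ι ι ℝ)) x⟫_ℝ =
      ⟪x, Matrix.toEuclideanLin G x⟫_ℝ + c * ‖x‖ ^ 2 := by
    simp [Matrix.toLpLin_one, inner_add_right, inner_smul_right]
  refine le_of_mul_le_mul_left ?_ (norm_pos_iff.mpr hx)
  calc ‖x‖ * (c * ‖x‖) ≤ ⟪x, Matrix.toEuclideanLin (G + c • (1 : Matrix ι ι ℝ)) x⟫_ℝ := by
        linarith [hG x, hinner]
    _ ≤ _ := real_inner_le_norm _ _

/-- If `G` is monotone and `0 < c` then `G + c I` is invertible. -/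
theorem isUnit_add_smul_one {ι : Type*} [Fintype ι] [DecidableEq ι]
    {G : Matrix ι ι ℝ}
    (hG : ∀ x : EuclideanSpace ℝ ι, 0 ≤ ⟪x, Matrix.toEuclideanLin G x⟫_ℝ)
    {c : ℝ} (hc : 0 < c) : IsUnit (G + c • (1 : Matrix ι ι ℝ)) := by
  rw [← Matrix.mulVec_injective_iff_isUnit]
  refine (injective_iff_map_eq_zero (G + c • (1 : Matrix ι ι ℝ)).mulVecLin).mpr fun v hv => ?_
  have h := mul_norm_le_norm_toEuclideanLin_add_smul_one hG c (WithLp.toLp 2 v)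
  have hzero : Matrix.toEuclideanLin (G + c • (1 : Matrix ι ι ℝ)) (WithLp.toLp 2 v) = 0 := by
    rw [Matrix.toLpLin_toLp]
    exact congrArg (WithLp.toLp 2) hv
  rw [hzero, norm_zero] at h
  have hnorm : ‖WithLp.toLp 2 v‖ = 0 :=
    le_antisymm (nonpos_of_mul_nonpos_right h hc) (norm_nonneg _)
  simpa using hnorm

theorem newton_step_norm_bound {d : ℕ}
    (F : EuclideanSpace ℝ (Fin d) → EuclideanSpace ℝ (Fin d))
    (z : EuclideanSpace ℝ (Fin d)) (hFz : F z ≠ 0)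
    (zstar : EuclideanSpace ℝ (Fin d)) (hFzstar : F zstar = 0)
    (θ τ L₂ : ℝ) (hθ : 0 < θ) (hτ : 0 < τ) (hL₂ : 0 < L₂)
    (G : Matrix (Fin d) (Fin d) ℝ)
    (hmono : ∀ x : EuclideanSpace ℝ (Fin d), 0 ≤ ⟪x, Matrix.toEuclideanLin G x⟫_ℝ)
    (hss : ‖F z - Matrix.toEuclideanLin G (z - zstar)‖ ≤ L₂ * ‖z - zstar‖ ^ 2)
    (herr : τ * ‖z - zstar‖ ≤ ‖F z‖)
    (Δz : EuclideanSpace ℝ (Fin d))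
    (hΔz : Δz = -(Matrix.toEuclideanLin
      (G + (θ * ‖F z‖) • (1 : Matrix (Fin d) (Fin d) ℝ))⁻¹ (F z))) :
    ‖Δz‖ ≤ (2 + L₂ / (θ * τ)) * ‖z - zstar‖ := by
  have hF : 0 < ‖F z‖ := norm_pos_iff.mpr hFz
  set c := θ * ‖F z‖ with hc_def
  have hc : 0 < c := mul_pos hθ hF
  set e := z - zstar
  set B := G + c • (1 : Matrix (Fin d) (Fin d) ℝ) with hB
  have hBΔ : Matrix.toEuclideanLin B Δz = -F z := by
    have hdet := (Matrix.isUnit_iff_isUnit_det B).mp (isUnit_add_smul_one hmono hc)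
    rw [hΔz, map_neg, ← LinearMap.comp_apply, ← Matrix.toLpLin_mul_same,
      Matrix.mul_nonsing_inv B hdet, Matrix.toLpLin_one, LinearMap.id_apply]
  have hBe : Matrix.toEuclideanLin B e = Matrix.toEuclideanLin G e + c • e := by
    simp [hB, Matrix.toLpLin_one]
  have hres : Matrix.toEuclideanLin B (Δz + e) =
      c • e - (F z - Matrix.toEuclideanLin G e) := by
    rw [map_add, hBΔ, hBe]
    abel
  have hstep : c * ‖Δz + e‖ ≤ c * ‖e‖ + L₂ * ‖e‖ ^ 2 := by
    calc c * ‖Δz + e‖ ≤ ‖c • e - (F z - Matrix.toEuclideanLin G e)‖ :=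
          hres ▸ mul_norm_le_norm_toEuclideanLin_add_smul_one hmono c (Δz + e)
      _ ≤ ‖c • e‖ + ‖F z - Matrix.toEuclideanLin G e‖ := norm_sub_le _ _
      _ ≤ c * ‖e‖ + L₂ * ‖e‖ ^ 2 := by
          rw [norm_smul, Real.norm_of_nonneg hc.le]
          gcongr
  have hquad : L₂ * ‖e‖ ^ 2 ≤ c * (L₂ / (θ * τ) * ‖e‖) := by
    calc L₂ * ‖e‖ ^ 2 = L₂ / (θ * τ) * ‖e‖ * (θ * (τ * ‖e‖)) := by field_simp
      _ ≤ L₂ / (θ * τ) * ‖e‖ * (θ * ‖F z‖) := by gcongr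
      _ = c * (L₂ / (θ * τ) * ‖e‖) := by rw [hc_def]; ring
  have hsum : ‖Δz + e‖ ≤ ‖e‖ + L₂ / (θ * τ) * ‖e‖ :=
    le_of_mul_le_mul_left (by linarith) hc
  have htri : ‖Δz‖ ≤ ‖Δz + e‖ + ‖e‖ := norm_le_add_norm_add Δz e
  linarith

end
end

section
/- Let F : ℝᵈ → ℝᵈ, let z ∈ ℝᵈ with F(z) ≠ 0, let z* ∈ ℝᵈ with F(z*) = 0, let θ, τ, L₁, L₂ > 0, and let G be a real d×d matrix such that: (a) ⟨x, Gx⟩ ≥ 0 for all x; (b) ‖F(z) - G(z - z*)‖ ≤ L₂‖z - z*‖²; (c) ‖F(z)‖ ≥ τ‖z - z*‖; (d) ‖F(z)‖ ≤ L₁‖z - z*‖; and, with Δz = -(G + θ‖F(z)‖·I)⁻¹ F(z), (e) ‖F(z + Δz) - F(z) - GΔz‖ ≤ L₂‖Δz‖². Then ‖F(z + Δz)‖ ≤ C‖F(z)‖², where C = (1/τ²)·[ L₂(2 + L₂/(θτ))² + θL₁(2 + L₂/(θτ)) ]. -/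
open Matrix
open scoped InnerProductSpace

noncomputable section

/-- A regularized monotone linear map is bounded below by the regularization parameter. -/
lemma mul_norm_le_norm_add_smul_of_monotone {E : Type*} [NormedAddCommGroup E]
    [InnerProductSpace ℝ E] {T : E →ₗ[ℝ] E} (hT : ∀ x, 0 ≤ ⟪x, T x⟫_ℝ) (μ : ℝ) (x : E) :
    μ * ‖x‖ ≤ ‖T x + μ • x‖ := by
  rcases eq_or_ne x 0 with rfl | hx
  · simp
  refine le_of_mul_le_mul_left ?_ (norm_pos_iff.mpr hx)
  calc ‖x‖ * (μ * ‖x‖) = μ * ⟪x, x⟫_ℝ := by rw [real_inner_self_eq_norm_sq]; ring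
    _ ≤ ⟪x, T x⟫_ℝ + μ * ⟪x, x⟫_ℝ := le_add_of_nonneg_left (hT x)
    _ = ⟪x, T x + μ • x⟫_ℝ := by rw [inner_add_right, real_inner_smul_right]
    _ ≤ ‖x‖ * ‖T x + μ • x‖ := real_inner_le_norm _ _

lemma toEuclideanLin_add_smul_one {ι : Type*} [Fintype ι] [DecidableEq ι] (G : Matrix ι ι ℝ)
    (μ : ℝ) (x : EuclideanSpace ℝ ι) :
    Matrix.toEuclideanLin (G + μ • (1 : Matrix ι ι ℝ)) x = Matrix.toEuclideanLin G x + μ • x := by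
  ext i
  simp

lemma isUnit_det_add_smul_one_of_monotone {ι : Type*} [Fintype ι] [DecidableEq ι]
    {G : Matrix ι ι ℝ} (hG : ∀ x : EuclideanSpace ℝ ι, 0 ≤ ⟪x, Matrix.toEuclideanLin G x⟫_ℝ)
    {μ : ℝ} (hμ : 0 < μ) : IsUnit (G + μ • (1 : Matrix ι ι ℝ)).det := by
  rw [isUnit_iff_ne_zero]
  intro hdet
  obtain ⟨v, hv, hv0⟩ := Matrix.exists_mulVec_eq_zero_iff.mpr hdet
  have h := mul_norm_le_norm_add_smul_of_monotone hG μ (WithLp.toLp 2 v)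
  rw [← toEuclideanLin_add_smul_one, Matrix.toLpLin_apply, hv0, WithLp.toLp_zero, norm_zero] at h
  have hpos : 0 < ‖WithLp.toLp 2 v‖ := norm_pos_iff.mpr (by simpa using hv)
  exact absurd h (not_le.mpr (mul_pos hμ hpos))

lemma toEuclideanLin_apply_inv_apply {ι : Type*} [Fintype ι] [DecidableEq ι]
    {M : Matrix ι ι ℝ} (hM : IsUnit M.det) (x : EuclideanSpace ℝ ι) :
    Matrix.toEuclideanLin M (Matrix.toEuclideanLin M⁻¹ x) = x := by
  ext i
  simp [Matrix.toLpLin_apply, Matrix.mulVec_mulVec, Matrix.mul_nonsing_inv M hM]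

theorem newton_one_step_quadratic {d : ℕ}
    (F : EuclideanSpace ℝ (Fin d) → EuclideanSpace ℝ (Fin d))
    (z : EuclideanSpace ℝ (Fin d)) (hFz : F z ≠ 0)
    (zstar : EuclideanSpace ℝ (Fin d)) (hFzstar : F zstar = 0)
    (θ τ L₁ L₂ : ℝ) (hθ : 0 < θ) (hτ : 0 < τ) (hL₁ : 0 < L₁) (hL₂ : 0 < L₂)
    (G : Matrix (Fin d) (Fin d) ℝ)
    (hmono : ∀ x : EuclideanSpace ℝ (Fin d), 0 ≤ ⟪x, Matrix.toEuclideanLin G x⟫_ℝ)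
    (hss : ‖F z - Matrix.toEuclideanLin G (z - zstar)‖ ≤ L₂ * ‖z - zstar‖ ^ 2)
    (herr : τ * ‖z - zstar‖ ≤ ‖F z‖)
    (hlip : ‖F z‖ ≤ L₁ * ‖z - zstar‖)
    (Δz : EuclideanSpace ℝ (Fin d))
    (hΔz : Δz = -(Matrix.toEuclideanLin
      (G + (θ * ‖F z‖) • (1 : Matrix (Fin d) (Fin d) ℝ))⁻¹ (F z)))
    (hss2 : ‖F (z + Δz) - F z - Matrix.toEuclideanLin G Δz‖ ≤ L₂ * ‖Δz‖ ^ 2) :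
    ‖F (z + Δz)‖ ≤
      (1 / τ ^ 2) * (L₂ * (2 + L₂ / (θ * τ)) ^ 2 + θ * L₁ * (2 + L₂ / (θ * τ)))
        * ‖F z‖ ^ 2 := by
  set e := z - zstar
  set T := Matrix.toEuclideanLin G
  set c := 2 + L₂ / (θ * τ) with hc
  have hF : 0 < ‖F z‖ := norm_pos_iff.mpr hFz
  have hμ : 0 < θ * ‖F z‖ := mul_pos hθ hF
  have hstep : T Δz + (θ * ‖F z‖) • Δz = -F z := by
    rw [← toEuclideanLin_add_smul_one, hΔz, map_neg,
      toEuclideanLin_apply_inv_apply (isUnit_det_add_smul_one_of_monotone hmono hμ)]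
  have hsum : θ * ‖F z‖ * ‖Δz + e‖ ≤ L₂ * ‖e‖ ^ 2 + θ * ‖F z‖ * ‖e‖ :=
    calc θ * ‖F z‖ * ‖Δz + e‖ ≤ ‖T (Δz + e) + (θ * ‖F z‖) • (Δz + e)‖ :=
          mul_norm_le_norm_add_smul_of_monotone hmono _ _
      _ = ‖(θ * ‖F z‖) • e - (F z - T e)‖ := by
          congr 1
          rw [map_add, smul_add, add_add_add_comm, hstep]
          abel
      _ ≤ ‖(θ * ‖F z‖) • e‖ + ‖F z - T e‖ := norm_sub_le _ _
      _ ≤ L₂ * ‖e‖ ^ 2 + θ * ‖F z‖ * ‖e‖ := by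
          rw [norm_smul, Real.norm_of_nonneg hμ.le, add_comm]
          gcongr
  have hquad : L₂ * ‖e‖ ^ 2 ≤ θ * ‖F z‖ * (L₂ / (θ * τ) * ‖e‖) :=
    calc L₂ * ‖e‖ ^ 2 = L₂ / τ * ‖e‖ * (τ * ‖e‖) := by field_simp
      _ ≤ L₂ / τ * ‖e‖ * ‖F z‖ := by gcongr
      _ = θ * ‖F z‖ * (L₂ / (θ * τ) * ‖e‖) := by field_simp
  have hΔ : ‖Δz‖ ≤ c * ‖e‖ := by
    have h1 : ‖Δz + e‖ ≤ L₂ / (θ * τ) * ‖e‖ + ‖e‖ :=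
      le_of_mul_le_mul_left (by linarith) hμ
    have h2 : ‖Δz‖ ≤ ‖Δz + e‖ + ‖e‖ := by simpa using norm_sub_le (Δz + e) e
    rw [hc]
    linarith
  have hc0 : 0 < c := by positivity
  have he : ‖e‖ ≤ ‖F z‖ / τ := by rwa [le_div_iff₀' hτ]
  calc ‖F (z + Δz)‖ = ‖(F (z + Δz) - F z - T Δz) - (θ * ‖F z‖) • Δz‖ := by
        rw [sub_sub, sub_sub, hstep, add_neg_cancel, sub_zero]
    _ ≤ ‖F (z + Δz) - F z - T Δz‖ + ‖(θ * ‖F z‖) • Δz‖ := norm_sub_le _ _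
    _ ≤ L₂ * ‖Δz‖ ^ 2 + θ * ‖F z‖ * ‖Δz‖ := by
        rw [norm_smul, Real.norm_of_nonneg hμ.le]
        gcongr
    _ ≤ L₂ * (c * ‖e‖) ^ 2 + θ * (L₁ * ‖e‖) * (c * ‖e‖) := by gcongr
    _ = (L₂ * c ^ 2 + θ * L₁ * c) * ‖e‖ ^ 2 := by ring
    _ ≤ (L₂ * c ^ 2 + θ * L₁ * c) * (‖F z‖ / τ) ^ 2 := by gcongr
    _ = 1 / τ ^ 2 * (L₂ * c ^ 2 + θ * L₁ * c) * ‖F z‖ ^ 2 := by ring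

end
end

section
/- For any two strategy profiles z₁ = (x₁, y₁) ∈ S and z₂ = (x₂, y₂) ∈ S, the duality gap satisfies |gap(z₁) - gap(z₂)| ≤ √2 ‖A‖ ‖z₁ - z₂‖, where ‖A‖ is the operator (spectral) norm of A and ‖z₁ - z₂‖ is the Euclidean norm on ℝ^{n+m}. -/
open Matrix
open scoped InnerProductSpace

noncomputable section

/-- The bilinear form of `A` is bounded by the spectral norm of `A`. -/
lemma abs_bilin_le_opNorm {n m : ℕ} (A : Matrix (Fin n) (Fin m) ℝ)
    (u : EuclideanSpace ℝ (Fin n)) (w : EuclideanSpace ℝ (Fin m)) :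
    |∑ i, ∑ j, u i * A i j * w j| ≤ opNorm A * ‖u‖ * ‖w‖ := by
  have hinner : ∑ i, ∑ j, u i * A i j * w j = ⟪u, Matrix.toEuclideanLin A w⟫_ℝ := by
    simp [PiLp.inner_apply, Matrix.toLpLin_apply, Matrix.mulVec, dotProduct,
      Finset.mul_sum, mul_assoc, mul_comm, mul_left_comm]
  have hop : ‖Matrix.toEuclideanLin A w‖ ≤ opNorm A * ‖w‖ :=
    (LinearMap.toContinuousLinearMap (Matrix.toEuclideanLin A)).le_opNorm w
  rw [hinner]
  calc _ ≤ ‖u‖ * ‖Matrix.toEuclideanLin A w‖ := abs_real_inner_le_norm _ _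
    _ ≤ ‖u‖ * (opNorm A * ‖w‖) := by gcongr
    _ = _ := by ring

lemma norm_le_one_of_mem_simplex {d : ℕ} {x : EuclideanSpace ℝ (Fin d)}
    (hx : x ∈ simplex d) : ‖x‖ ≤ 1 := by
  obtain ⟨hnonneg, hsum⟩ := hx
  rw [← sq_le_one_iff₀ (norm_nonneg x), EuclideanSpace.real_norm_sq_eq, ← hsum]
  refine Finset.sum_le_sum fun i _ => ?_
  have : x i ≤ 1 := hsum ▸ Finset.single_le_sum (fun j _ => hnonneg j) (Finset.mem_univ i)
  nlinarith [hnonneg i]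

lemma abs_sSup_image_sub_le {α : Type*} {s : Set α} (hs : s.Nonempty) {f g : α → ℝ} {c : ℝ}
    (hf : BddAbove (f '' s)) (hg : BddAbove (g '' s)) (h : ∀ a ∈ s, |f a - g a| ≤ c) :
    |sSup (f '' s) - sSup (g '' s)| ≤ c := by
  have key : ∀ {p q : α → ℝ}, BddAbove (q '' s) → (∀ a ∈ s, |p a - q a| ≤ c) →
      sSup (p '' s) ≤ sSup (q '' s) + c := by
    intro p q hq hpq
    refine csSup_le (hs.image p) ?_
    rintro _ ⟨a, ha, rfl⟩
    linarith [le_csSup hq (Set.mem_image_of_mem q ha), (abs_le.mp (hpq a ha)).2]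
  rw [abs_le]
  constructor <;> linarith [key hg h, key hf fun a ha => abs_sub_comm (f a) (g a) ▸ h a ha]

lemma abs_sInf_image_sub_le {α : Type*} {s : Set α} (hs : s.Nonempty) {f g : α → ℝ} {c : ℝ}
    (hf : BddBelow (f '' s)) (hg : BddBelow (g '' s)) (h : ∀ a ∈ s, |f a - g a| ≤ c) :
    |sInf (f '' s) - sInf (g '' s)| ≤ c := by
  have key : ∀ {p q : α → ℝ}, BddBelow (p '' s) → (∀ a ∈ s, |p a - q a| ≤ c) →
      sInf (p '' s) ≤ sInf (q '' s) + c := by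
    intro p q hp hpq
    rw [← sub_le_iff_le_add]
    refine le_csInf (hs.image q) ?_
    rintro _ ⟨a, ha, rfl⟩
    linarith [csInf_le hp (Set.mem_image_of_mem p ha), (abs_le.mp (hpq a ha)).2]
  rw [abs_le]
  constructor <;> linarith [key hf h, key hg fun a ha => abs_sub_comm (f a) (g a) ▸ h a ha]

lemma abs_sSup_bilin_sub_le {n m : ℕ} (A : Matrix (Fin n) (Fin m) ℝ)
    (hs : (simplex m).Nonempty) (u v : EuclideanSpace ℝ (Fin n)) :
    |sSup ((fun y : EuclideanSpace ℝ (Fin m) => ∑ i, ∑ j, u i * A i j * y j) '' simplex m)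
      - sSup ((fun y : EuclideanSpace ℝ (Fin m) => ∑ i, ∑ j, v i * A i j * y j) '' simplex m)|
      ≤ opNorm A * ‖u - v‖ := by
  have bound : ∀ w : EuclideanSpace ℝ (Fin n), ∀ y ∈ simplex m,
      |∑ i, ∑ j, w i * A i j * y j| ≤ opNorm A * ‖w‖ := fun w y hy =>
    (abs_bilin_le_opNorm A w y).trans <| mul_le_of_le_one_right
      (mul_nonneg (norm_nonneg _) (norm_nonneg _)) (norm_le_one_of_mem_simplex hy)
  have bdd : ∀ w : EuclideanSpace ℝ (Fin n), BddAbove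
      ((fun y : EuclideanSpace ℝ (Fin m) => ∑ i, ∑ j, w i * A i j * y j) '' simplex m) := by
    refine fun w => ⟨opNorm A * ‖w‖, ?_⟩
    rintro _ ⟨y, hy, rfl⟩
    exact (le_abs_self _).trans (bound w y hy)
  refine abs_sSup_image_sub_le hs (bdd u) (bdd v) fun y hy => ?_
  simpa [sub_mul, Finset.sum_sub_distrib] using bound (u - v) y hy

lemma abs_sInf_bilin_sub_le {n m : ℕ} (A : Matrix (Fin n) (Fin m) ℝ)
    (hs : (simplex n).Nonempty) (u v : EuclideanSpace ℝ (Fin m)) :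
    |sInf ((fun x : EuclideanSpace ℝ (Fin n) => ∑ i, ∑ j, x i * A i j * u j) '' simplex n)
      - sInf ((fun x : EuclideanSpace ℝ (Fin n) => ∑ i, ∑ j, x i * A i j * v j) '' simplex n)|
      ≤ opNorm A * ‖u - v‖ := by
  have bound : ∀ w : EuclideanSpace ℝ (Fin m), ∀ x ∈ simplex n,
      |∑ i, ∑ j, x i * A i j * w j| ≤ opNorm A * ‖w‖ := fun w x hx =>
    (abs_bilin_le_opNorm A x w).trans <| mul_le_mul_of_nonneg_right
      (mul_le_of_le_one_right (norm_nonneg _) (norm_le_one_of_mem_simplex hx)) (norm_nonneg _)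
  have bdd : ∀ w : EuclideanSpace ℝ (Fin m), BddBelow
      ((fun x : EuclideanSpace ℝ (Fin n) => ∑ i, ∑ j, x i * A i j * w j) '' simplex n) := by
    refine fun w => ⟨-(opNorm A * ‖w‖), ?_⟩
    rintro _ ⟨x, hx, rfl⟩
    exact (abs_le.mp (bound w x hx)).1
  refine abs_sInf_image_sub_le hs (bdd u) (bdd v) fun x hx => ?_
  simpa [mul_sub, Finset.sum_sub_distrib] using bound (u - v) x hx

theorem gap_lipschitz {n m : ℕ} (A : Matrix (Fin n) (Fin m) ℝ) :
    ∀ z₁ ∈ gameSet n m, ∀ z₂ ∈ gameSet n m,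
      |gap A z₁ - gap A z₂| ≤ Real.sqrt 2 * opNorm A * ‖z₁ - z₂‖ := by
  intro z₁ hz₁ z₂ _
  let fstPart (z : EuclideanSpace ℝ (Fin n ⊕ Fin m)) : EuclideanSpace ℝ (Fin n) :=
    WithLp.toLp 2 fun i => z (Sum.inl i)
  let sndPart (z : EuclideanSpace ℝ (Fin n ⊕ Fin m)) : EuclideanSpace ℝ (Fin m) :=
    WithLp.toLp 2 fun j => z (Sum.inr j)
  have hsup := abs_sSup_bilin_sub_le A ⟨sndPart z₁, fun j => hz₁.1 (Sum.inr j), hz₁.2.2⟩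
    (fstPart z₁) (fstPart z₂)
  have hinf := abs_sInf_bilin_sub_le A ⟨fstPart z₁, fun i => hz₁.1 (Sum.inl i), hz₁.2.1⟩
    (sndPart z₁) (sndPart z₂)
  set a := ‖fstPart z₁ - fstPart z₂‖ with ha
  set b := ‖sndPart z₁ - sndPart z₂‖ with hb
  have hnorm : a ^ 2 + b ^ 2 = ‖z₁ - z₂‖ ^ 2 := by
    simp [ha, hb, fstPart, sndPart, EuclideanSpace.real_norm_sq_eq]
  have hab : a + b ≤ Real.sqrt 2 * ‖z₁ - z₂‖ := by
    refine abs_le_of_sq_le_sq' ?_ (by positivity) |>.2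
    rw [mul_pow, Real.sq_sqrt zero_le_two, ← hnorm]
    exact add_sq_le
  have hgap : |gap A z₁ - gap A z₂| ≤ opNorm A * a + opNorm A * b := by
    unfold gap
    rw [sub_sub_sub_comm]
    exact (abs_sub _ _).trans (add_le_add hsup hinf)
  calc _ ≤ opNorm A * (a + b) := by rwa [mul_add]
    _ ≤ opNorm A * (Real.sqrt 2 * ‖z₁ - z₂‖) := mul_le_mul_of_nonneg_left hab (norm_nonneg _)
    _ = _ := by ring

end
end
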